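/- Let K be a field of characteristic zero, V a finite-dimensional K-vector space, x ∈ V a nonzero vector, and a ∈ T(V). If |a x^l| = 0 in |T(V)| for every integer l ≥ 1, then there exists b ∈ T(V) such that a = xb − bx. (Proposition 3.8, quoted from Proposition A.2 of [AKKN, genus 0] and used as a key tool; stated in the uncompleted tensor algebra, which is equivalent to the completed version degree by degree.) -/

import Mathlib

/-!
STATEMENT 13 (Proposition 3.8 / Proposition A.2 of [AKKN, genus 0]): if `x ∈ V` is nonzero
and `|a x^l| = 0` in `|T(V)|` for all `l ≥ 1`, then `a ∈ [x, T(V)]`.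
-/

noncomputable section

variable (K : Type*) [Field K] [CharZero K]
variable (V : Type*) [AddCommGroup V] [Module K V]

/-- The linear span of commutators `a*b - b*a` in the tensor algebra. -/
def commT : Submodule K (TensorAlgebra K V) :=
  Submodule.span K {x | ∃ a b : TensorAlgebra K V, x = a * b - b * a}

/-- The projection `a ↦ |a|` from `T(V)` onto the space of cyclic words
`|T(V)| = T(V)/[T(V),T(V)]`. -/
def tr : TensorAlgebra K V →ₗ[K] TensorAlgebra K V ⧸ commT K V :=
  (commT K V).mkQ

open List in
lemma List.IsRotated.exists_replicate_append {α : Type*} {c : α} {w w' : List α} {l : ℕ}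
    (hl : w.length < l) (h : w ++ replicate l c ~r w' ++ replicate l c) :
    ∃ k t, (w = replicate k c ++ t ∧ w' = t ++ replicate k c) ∨
      (w = t ++ replicate k c ∧ w' = replicate k c ++ t) := by
  obtain ⟨p, s, hps, hsp⟩ : ∃ p s, w ++ replicate l c = p ++ s ∧ w' ++ replicate l c = s ++ p := by
    obtain ⟨n, hn⟩ := h
    rw [rotate_eq_drop_append_take_mod] at hn
    exact ⟨_, _, (take_append_drop _ _).symm, hn.symm⟩
  rcases append_eq_append_iff.1 hps with ⟨as, rfl, has⟩ | ⟨t, rfl, rfl⟩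
  · obtain ⟨hlen, h1, h2⟩ := append_eq_replicate_iff.1 has.symm
    have hw : w' ++ replicate s.length c = replicate s.length c ++ w := by
      rw [h2, h1, ← hlen, Nat.add_comm, ← replicate_append_replicate] at hsp
      simpa only [← append_assoc, append_cancel_right_eq, length_replicate] using hsp
    rcases append_eq_append_iff.1 hw with ⟨u, hu, hu'⟩ | ⟨t, ht, ht'⟩
    · obtain ⟨hlen₁, h₁, -⟩ := append_eq_replicate_iff.1 hu.symm
      obtain ⟨hlen₂, -, h₂⟩ := append_eq_replicate_iff.1 hu'.symm
      refine ⟨w.length, [], Or.inl ⟨by simpa using h₂, ?_⟩⟩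
      rw [h₁, show w'.length = w.length by omega]
      simp
    · exact ⟨s.length, t, Or.inr ⟨ht', ht⟩⟩
  · rw [length_append] at hl
    have hp : p = replicate p.length c := by
      rcases append_eq_append_iff.1 hsp with ⟨u, -, hu⟩ | ⟨u, -, hu⟩
      · exact (append_eq_replicate_iff.1 hu.symm).2.2
      · have := congrArg length hu
        simp only [length_append, length_replicate] at this
        omega
    refine ⟨p.length, t, Or.inl ⟨by rw [← hp], ?_⟩⟩
    rw [hp, append_assoc, replicate_append_replicate, Nat.add_comm,
      ← replicate_append_replicate, ← append_assoc, append_cancel_right_eq] at hsp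
    simpa using hsp

lemma Module.Basis.tensorAlgebra_mul {κ R M : Type*} [CommSemiring R] [AddCommMonoid M]
    [Module R M] (b : Module.Basis κ R M) (v w : FreeMonoid κ) :
    b.tensorAlgebra (v * w) = b.tensorAlgebra v * b.tensorAlgebra w := by
  simp [Module.Basis.tensorAlgebra, FreeAlgebra.basisFreeMonoid,
    FreeAlgebra.equivMonoidAlgebraFreeMonoid, map_mul]

lemma Module.Basis.tensorAlgebra_of {κ R M : Type*} [CommSemiring R] [AddCommMonoid M]
    [Module R M] (b : Module.Basis κ R M) (i : κ) :
    b.tensorAlgebra (FreeMonoid.of i) = TensorAlgebra.ι R (b i) := by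
  simp [Module.Basis.tensorAlgebra, FreeAlgebra.basisFreeMonoid,
    FreeAlgebra.equivMonoidAlgebraFreeMonoid]

lemma Module.Basis.tensorAlgebra_replicate {κ R M : Type*} [CommSemiring R] [AddCommMonoid M]
    [Module R M] (b : Module.Basis κ R M) (i : κ) (l : ℕ) :
    b.tensorAlgebra (FreeMonoid.ofList (List.replicate l i)) = TensorAlgebra.ι R (b i) ^ l := by
  induction l with
  | zero =>
    simp [Module.Basis.tensorAlgebra, FreeAlgebra.basisFreeMonoid, ← MonoidAlgebra.one_def]
  | succ l ih =>
    rw [List.replicate_succ, FreeMonoid.ofList_cons, b.tensorAlgebra_mul, b.tensorAlgebra_of, ih,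
      pow_succ']

/-- A linear map out of the tensor algebra prescribed on basis words through their cyclic class
vanishes on commutators. -/
lemma commT_le_ker_constr {F M κ Q : Type*} [Field F] [AddCommGroup M] [Module F M]
    [AddCommGroup Q] [Module F Q] (b : Module.Basis κ F M) (g : Cycle κ → Q) :
    commT F M ≤ LinearMap.ker
      (b.tensorAlgebra.constr F fun w ↦ g (FreeMonoid.toList w : Cycle κ)) := by
  set φ := b.tensorAlgebra.constr F fun w ↦ g (FreeMonoid.toList w : Cycle κ) with hφ
  have key : (LinearMap.mul F (TensorAlgebra F M)).compr₂ φ =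
      (LinearMap.mul F (TensorAlgebra F M)).flip.compr₂ φ := by
    refine b.tensorAlgebra.ext fun v ↦ b.tensorAlgebra.ext fun w ↦ ?_
    simp only [LinearMap.compr₂_apply, LinearMap.mul_apply', LinearMap.flip_apply,
      ← b.tensorAlgebra_mul, hφ, Module.Basis.constr_basis, FreeMonoid.toList_mul]
    exact congrArg g (Cycle.coe_eq_coe.2 List.isRotated_append)
  refine Submodule.span_le.2 ?_
  rintro _ ⟨p, q, rfl⟩
  simpa [sub_eq_zero] using LinearMap.congr_fun₂ key p q

lemma Module.exists_basis_apply_eq {K V : Type*} [DivisionRing K] [AddCommGroup V] [Module K V]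
    {x : V} (hx : x ≠ 0) : ∃ (κ : Set V) (b : Module.Basis κ K V) (i : κ), b i = x := by
  have hs : LinearIndepOn K id ({x} : Set V) := LinearIndepOn.singleton hx
  exact ⟨_, Module.Basis.extend hs, ⟨x, Module.Basis.subset_extend hs rfl⟩,
    Module.Basis.extend_apply_self hs _⟩

/-- The operator `b ↦ x b - b x` on the tensor algebra. -/
def commutatorWith (x : V) : TensorAlgebra K V →ₗ[K] TensorAlgebra K V :=
  LinearMap.mulLeft K (TensorAlgebra.ι K x) - LinearMap.mulRight K (TensorAlgebra.ι K x)

lemma mkQ_range_commutatorWith_pow_mul {F M : Type*} [Field F] [AddCommGroup M] [Module F M]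
    (x : M) (k : ℕ) (t : TensorAlgebra F M) :
    (commutatorWith F M x).range.mkQ (TensorAlgebra.ι F x ^ k * t) =
      (commutatorWith F M x).range.mkQ (t * TensorAlgebra.ι F x ^ k) := by
  induction k generalizing t with
  | zero => simp
  | succ k ih =>
    have hx : (commutatorWith F M x).range.mkQ (TensorAlgebra.ι F x * (t * TensorAlgebra.ι F x ^ k))
        = (commutatorWith F M x).range.mkQ (t * TensorAlgebra.ι F x ^ k * TensorAlgebra.ι F x) := by
      rw [← sub_eq_zero, ← map_sub, Submodule.mkQ_apply, Submodule.Quotient.mk_eq_zero]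
      exact ⟨t * TensorAlgebra.ι F x ^ k, rfl⟩
    rw [pow_succ, mul_assoc, ih, mul_assoc, hx, mul_assoc]

theorem stmt13 [FiniteDimensional K V] (x : V) (hx : x ≠ 0)
    (a : TensorAlgebra K V)
    (h : ∀ l : ℕ, 1 ≤ l → tr K V (a * (TensorAlgebra.ι K x) ^ l) = 0) :
    ∃ b : TensorAlgebra K V,
      a = TensorAlgebra.ι K x * b - b * TensorAlgebra.ι K x := by
  obtain ⟨κ, b, i, rfl⟩ := Module.exists_basis_apply_eq (K := K) hx
  set q := (commutatorWith K V (b i)).range.mkQ with hq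
  suffices hqa : q a = 0 by
    rw [hq, Submodule.mkQ_apply, Submodule.Quotient.mk_eq_zero] at hqa
    obtain ⟨y, hy⟩ := hqa
    exact ⟨y, by simpa [commutatorWith] using hy.symm⟩
  set B := b.tensorAlgebra
  obtain ⟨l, hl⟩ : ∃ l, ∀ w ∈ (B.repr a).support, (FreeMonoid.toList w).length ≤ l :=
    ⟨_, fun w hw ↦ Finset.le_sup (f := fun w ↦ (FreeMonoid.toList w).length) hw⟩
  let close (w : {w : List κ // w.length < l + 1}) : Cycle κ :=
    ((w : List κ) ++ List.replicate (l + 1) i : List κ)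
  let f (w : {w : List κ // w.length < l + 1}) := q (B (FreeMonoid.ofList w))
  have hf : f.FactorsThrough close := by
    rintro ⟨v, hv⟩ ⟨w, hw⟩ hvw
    obtain ⟨k, t, ⟨rfl, rfl⟩ | ⟨rfl, rfl⟩⟩ :=
      List.IsRotated.exists_replicate_append hv (Cycle.coe_eq_coe.1 hvw)
    all_goals
      simp only [f, B, FreeMonoid.ofList_append, b.tensorAlgebra_mul, b.tensorAlgebra_replicate,
        hq, mkQ_range_commutatorWith_pow_mul]
  let φ := B.constr K fun w ↦ Function.extend close f 0 (FreeMonoid.toList w : Cycle κ)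
  have hφ : φ (a * TensorAlgebra.ι K (b i) ^ (l + 1)) = 0 :=
    commT_le_ker_constr b _ ((Submodule.Quotient.mk_eq_zero _).1 (h (l + 1) (by omega)))
  rw [← hφ, ← B.linearCombination_repr a, Finsupp.linearCombination_apply, Finsupp.sum,
    Finset.sum_mul, map_sum, map_sum]
  refine Finset.sum_congr rfl fun w hw ↦ ?_
  have hw' := hf.extend_apply 0 ⟨FreeMonoid.toList w, Nat.lt_succ_of_le (hl w hw)⟩
  rw [smul_mul_assoc, map_smul, map_smul, ← b.tensorAlgebra_replicate, ← b.tensorAlgebra_mul,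
    B.constr_basis, FreeMonoid.toList_mul, FreeMonoid.toList_ofList]
  exact congrArg _ hw'.symm

end
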